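/- arXiv:2008.11690 — 2 statements merged into one kernel-verified Lean document; each statement's English description precedes it below -/
import Mathlib

section
/- With q and 𝓗 as above, q 𝓗 = 0: the Hamiltonian function 𝓗 = 𝒱_{ab}(ξ)(ρ^a{}_c ρ^{cb} + ((n−2)λ/n) ξ^a ξ^b) is annihilated by the Chevalley-Eilenberg differential q. -/
open scoped BigOperators

noncomputable def eps {n : ℕ} (g : Fin n → Fin n) : ℝ :=
  ∑ σ : Equiv.Perm (Fin n),
    if (σ : Fin n → Fin n) = g then ((Equiv.Perm.sign σ : ℤ) : ℝ) else 0

def cat2 {n : ℕ} (a b : Fin n) (f : Fin (n - 2) → Fin n) : Fin n → Fin n :=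
  fun i =>
    if i.val = 0 then a
    else if i.val = 1 then b
    else if h : i.val - 2 < n - 2 then f ⟨i.val - 2, h⟩ else a

noncomputable def Vtwo {n : ℕ} {A : Type*} [Ring A] [Algebra ℝ A]
    (ξ : Fin n → A) (a b : Fin n) : A :=
  ((Nat.factorial (n - 2) : ℝ))⁻¹ •
    ∑ f : Fin (n - 2) → Fin n,
      eps (cat2 a b f) • (List.ofFn fun j => ξ (f j)).prod

theorem eps_perm {n : ℕ} (g : Fin n → Fin n) (τ : Equiv.Perm (Fin n)) :
    eps (g ∘ τ) = ((Equiv.Perm.sign τ : ℤ) : ℝ) * eps g := by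
  unfold eps
  rw [Finset.mul_sum]
  refine (Fintype.sum_equiv (Equiv.mulRight τ) _ _ fun σ => ?_).symm
  have h : ((Equiv.mulRight τ σ : Equiv.Perm (Fin n)) : Fin n → Fin n) = g ∘ τ ↔
      (σ : Fin n → Fin n) = g := by
    constructor
    · intro h
      funext x
      have := congrFun h (τ.symm x)
      simpa using this
    · rintro rfl
      rfl
  simp only [h]
  split_ifs
  · simp [mul_comm]
  · simp

theorem eps_swap {n : ℕ} (g : Fin n → Fin n) {i j : Fin n} (h : i ≠ j) :
    eps (g ∘ Equiv.swap i j) = - eps g := by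
  rw [eps_perm, Equiv.Perm.sign_swap h]; simp

theorem eps_eq_zero {n : ℕ} (g : Fin n → Fin n) (h : ¬ Function.Injective g) : eps g = 0 := by
  unfold eps
  refine Finset.sum_eq_zero fun σ _ => if_neg ?_
  rintro rfl
  exact h σ.injective

theorem eps_invariant {n : ℕ} {A : Type*} [AddCommGroup A] [Module ℝ A]
    (M : Fin n → Fin n → A) (h : Fin n → Fin n) :
    ∑ i, ∑ e, eps (Function.update h i e) • M e (h i) = eps h • ∑ a, M a a := by
  by_cases hi : Function.Injective h
  · have hb : Function.Bijective h := Finite.injective_iff_bijective.mp hi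
    rw [← hb.sum_comp (fun a => M a a), Finset.smul_sum]
    refine Finset.sum_congr rfl fun i _ => ?_
    rw [Finset.sum_eq_single (h i)]
    · simp
    · intro e _ he
      obtain ⟨j, rfl⟩ := hb.surjective e
      rw [eps_eq_zero, zero_smul]
      intro hinj
      have hji : j ≠ i := fun hh => he (by rw [hh])
      apply hji
      apply hinj
      simp [hji]
    · simp
  · rw [eps_eq_zero h hi, zero_smul]
    simp only [Function.Injective, not_forall] at hi
    obtain ⟨i, j, hij, hne⟩ := hi
    rw [← Finset.add_sum_erase _ _ (Finset.mem_univ i),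
      ← Finset.add_sum_erase _ _ (Finset.mem_erase.mpr ⟨Ne.symm hne, Finset.mem_univ j⟩),
      Finset.sum_eq_zero (s := (Finset.univ.erase i).erase j), add_zero,
      ← Finset.sum_add_distrib]
    · refine Finset.sum_eq_zero fun e _ => ?_
      have : Function.update h j e = Function.update h i e ∘ Equiv.swap i j := by
        funext x
        by_cases hxi : x = i
        · subst hxi
          simp [hne, Ne.symm hne, hij]
        · by_cases hxj : x = j
          · subst hxj; simp
          · simp [hxi, hxj, Equiv.swap_apply_of_ne_of_ne]
      rw [this, eps_swap _ hne, hij]; simp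
    · intro k hk
      simp only [Finset.mem_erase, Finset.mem_univ, and_true] at hk
      refine Finset.sum_eq_zero fun e _ => ?_
      rw [eps_eq_zero, zero_smul]
      intro hinj
      apply hne
      apply hinj
      simp [Ne.symm hk.1, Ne.symm hk.2, hij]

theorem sum_update {k n : ℕ} {A : Type*} [AddCommMonoid A] (j : Fin k)
    (G : (Fin k → Fin n) → Fin n → A) :
    ∑ f, ∑ d, G f d = ∑ f, ∑ d, G (Function.update f j d) (f j) := by
  rw [← Fintype.sum_prod_type', ← Fintype.sum_prod_type']
  have hinv : Function.Involutive
      (fun p : (Fin k → Fin n) × Fin n => (Function.update p.1 j p.2, p.1 j)) := by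
    rintro ⟨f, d⟩
    simp
  exact (Fintype.sum_equiv hinv.toPerm _ _ fun p => rfl).symm

theorem sum_cons {k n : ℕ} {A : Type*} [AddCommMonoid A] (G : (Fin (k+1) → Fin n) → A) :
    ∑ f, G f = ∑ a, ∑ f : Fin k → Fin n, G (Fin.cons a f) := by
  rw [← Fintype.sum_prod_type']
  exact (Fintype.sum_equiv (Fin.consEquiv (fun _ => Fin n)) _ _ fun p => rfl).symm

/-- ordered product of the odd generators -/
def XX {n k : ℕ} {A : Type*} [Ring A] (ξ : Fin n → A) (f : Fin k → Fin n) : A :=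
  (List.ofFn fun j => ξ (f j)).prod

theorem XX_cons {n k : ℕ} {A : Type*} [Ring A] (ξ : Fin n → A) (a : Fin n) (f : Fin k → Fin n) :
    XX ξ (Fin.cons a f : Fin (k+1) → Fin n) = ξ a * XX ξ f := by
  simp [XX, List.ofFn_succ]

theorem XX_swap {n k : ℕ} {A : Type*} [Ring A] [Algebra ℝ A] (ξ : Fin n → A)
    (hξξ : ∀ a b, ξ a * ξ b = - (ξ b * ξ a)) (f : Fin k → Fin n) {i j : Fin k} (h : i ≠ j) :
    XX ξ (f ∘ Equiv.swap i j) = - XX ξ f := by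
  let φ : (Fin n → ℝ) →ₗ[ℝ] A := Fintype.linearCombination ℝ ξ
  have hφ : ∀ x, φ x * φ x = 0 := by
    intro x
    have h1 : φ x * φ x = - (φ x * φ x) := by
      simp only [φ, Fintype.linearCombination_apply]
      rw [Finset.sum_mul_sum]
      conv_rhs => rw [Finset.sum_comm]
      simp only [← Finset.sum_neg_distrib]
      refine Finset.sum_congr rfl fun a _ => Finset.sum_congr rfl fun b _ => ?_
      rw [smul_mul_smul_comm, smul_mul_smul_comm, hξξ a b, smul_neg, mul_comm]
    have h2 : (2:ℝ) • (φ x * φ x) = 0 := by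
      rw [two_smul]
      nth_rewrite 1 [h1]
      simp
    simpa using h2
  have key : ∀ g : Fin k → Fin n, XX ξ g = ExteriorAlgebra.lift ℝ ⟨φ, hφ⟩
      (ExteriorAlgebra.ιMulti ℝ k (fun j => (Pi.single (g j) (1:ℝ) : Fin n → ℝ))) := by
    intro g
    rw [ExteriorAlgebra.ιMulti_apply, map_list_prod, List.map_ofFn]
    unfold XX
    congr 2
    funext j
    simp [φ]
  rw [key, key, ← map_neg, ← AlternatingMap.map_swap _ _ h]
  rfl

theorem Vtwo_eq {m : ℕ} {A : Type*} [Ring A] [Algebra ℝ A] (ξ : Fin (m+2) → A)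
    (a b : Fin (m+2)) :
    Vtwo ξ a b = ((Nat.factorial m : ℝ))⁻¹ • ∑ f : Fin m → Fin (m+2),
      eps (Fin.cons a (Fin.cons b f : Fin (m+1) → Fin (m+2)) : Fin (m+2) → Fin (m+2)) •
        XX ξ f := by
  have h : ∀ f : Fin m → Fin (m+2), cat2 a b f =
      (Fin.cons a (Fin.cons b f : Fin (m+1) → Fin (m+2)) : Fin (m+2) → Fin (m+2)) := by
    intro f
    funext i
    refine Fin.cases ?_ (fun i => ?_) i
    · simp [cat2]
    · refine Fin.cases ?_ (fun i => ?_) i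
      · simp [cat2]
      · simp [cat2]
  unfold Vtwo
  simp only [← h]
  rfl

theorem Vtwo_antisymm {m : ℕ} {A : Type*} [Ring A] [Algebra ℝ A] (ξ : Fin (m+2) → A)
    (a b : Fin (m+2)) : Vtwo ξ a b = - Vtwo ξ b a := by
  rw [Vtwo_eq, Vtwo_eq, ← smul_neg, ← Finset.sum_neg_distrib]
  congr 1
  refine Finset.sum_congr rfl fun f _ => ?_
  rw [← neg_smul]
  congr 1
  rw [← eps_swap _ (show (0 : Fin (m+2)) ≠ 1 by simp)]
  congr 1
  funext i
  refine Fin.cases ?_ (fun i => ?_) i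
  · simp [Fin.cons_one]
  · refine Fin.cases ?_ (fun i => ?_) i
    · simp
    · have h1 : (i.succ.succ : Fin (m+2)) ≠ 0 := Fin.succ_ne_zero _
      have h2 : (i.succ.succ : Fin (m+2)) ≠ 1 := by
        rw [← Fin.succ_zero_eq_one]
        exact fun h => Fin.succ_ne_zero _ (Fin.succ_injective _ h)
      simp [Equiv.swap_apply_of_ne_of_ne h1 h2]

theorem M_XX {n k : ℕ} {A : Type*} [Ring A] [Algebra ℝ A] (ξ : Fin n → A) (μ : A)
    (h : ∀ x, ξ x * μ = - (μ * ξ x)) (f : Fin k → Fin n) :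
    μ * XX ξ f = ((-1:ℝ)^k) • (XX ξ f * μ) := by
  induction k with
  | zero => simp [XX]
  | succ k ih =>
    rw [← Fin.cons_self_tail f, XX_cons, ← mul_assoc, ← neg_eq_iff_eq_neg.mpr (h _), neg_mul,
      mul_assoc, ih, pow_succ]
    simp [mul_assoc]

theorem M_V {m : ℕ} {A : Type*} [Ring A] [Algebra ℝ A] (ξ : Fin (m+2) → A) (μ : A)
    (h : ∀ x, ξ x * μ = - (μ * ξ x)) (a b : Fin (m+2)) :
    μ * Vtwo ξ a b = ((-1:ℝ)^m) • (Vtwo ξ a b * μ) := by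
  rw [Vtwo_eq]
  simp only [mul_smul_comm, smul_mul_assoc, Finset.mul_sum, Finset.sum_mul, Finset.smul_sum]
  refine Finset.sum_congr rfl fun f _ => ?_
  rw [M_XX ξ μ h]
  module

theorem q_XX {n k : ℕ} {A : Type*} [Ring A] [Algebra ℝ A] (ξ : Fin n → A)
    (M : Fin n → Fin n → A) (q : A →ₗ[ℝ] A)
    (hM : ∀ x a d, ξ x * M a d = - (M a d * ξ x))
    (hq : ∀ a x, q (ξ a * x) = (∑ d, M a d * ξ d) * x - ξ a * q x)
    (f : Fin k → Fin n) (y : A) :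
    q (XX ξ f * y) = (∑ j, ∑ d, M (f j) d * XX ξ (Function.update f j d)) * y
      + ((-1:ℝ)^k) • (XX ξ f * q y) := by
  induction k with
  | zero => simp [XX]
  | succ k ih =>
    obtain ⟨a, t, rfl⟩ : ∃ a t, f = (Fin.cons a t : Fin (k+1) → Fin n) :=
      ⟨f 0, Fin.tail f, (Fin.cons_self_tail f).symm⟩
    rw [XX_cons, mul_assoc, hq, ih, Fin.sum_univ_succ]
    simp only [Fin.cons_zero, Fin.cons_succ, Fin.update_cons_zero, ← Fin.cons_update, XX_cons]
    have h2 : ∑ j, ∑ d, M (t j) d * (ξ a * XX ξ (Function.update t j d)) =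
        - (ξ a * ∑ j, ∑ d, M (t j) d * XX ξ (Function.update t j d)) := by
      simp only [Finset.mul_sum, ← Finset.sum_neg_distrib]
      refine Finset.sum_congr rfl fun j _ => Finset.sum_congr rfl fun d _ => ?_
      rw [← mul_assoc, ← mul_assoc, hM]; simp
    rw [h2]
    simp only [← mul_assoc, ← Finset.sum_mul, pow_succ, mul_add, add_mul, mul_smul_comm]
    simp [mul_assoc]
    abel

theorem q_V {m : ℕ} {A : Type*} [Ring A] [Algebra ℝ A] (ξ : Fin (m+2) → A)
    (M : Fin (m+2) → Fin (m+2) → A) (q : A →ₗ[ℝ] A)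
    (hM : ∀ x a d, ξ x * M a d = - (M a d * ξ x))
    (htr : ∑ a, M a a = 0)
    (hq : ∀ a x, q (ξ a * x) = (∑ d, M a d * ξ d) * x - ξ a * q x)
    (a b : Fin (m+2)) (y : A) :
    q (Vtwo ξ a b * y) = - ((∑ e, M e a * Vtwo ξ e b) + ∑ e, M e b * Vtwo ξ a e) * y
      + ((-1:ℝ)^m) • (Vtwo ξ a b * q y) := by
  have key : ∑ f : Fin m → Fin (m+2),
      eps (Fin.cons a (Fin.cons b f : Fin (m+1) → Fin (m+2)) : Fin (m+2) → Fin (m+2)) •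
        (∑ j, ∑ d, M (f j) d * XX ξ (Function.update f j d)) =
      ∑ f : Fin m → Fin (m+2), - ((∑ e, eps (Fin.cons e (Fin.cons b f : Fin (m+1) → Fin (m+2)) :
        Fin (m+2) → Fin (m+2)) • M e a) + ∑ e, eps (Fin.cons a (Fin.cons e f :
          Fin (m+1) → Fin (m+2)) : Fin (m+2) → Fin (m+2)) • M e b) * XX ξ f := by
    simp only [Finset.smul_sum]
    rw [Finset.sum_comm]
    have h1 : ∀ j : Fin m, ∑ f : Fin m → Fin (m+2), ∑ d,
        eps (Fin.cons a (Fin.cons b f : Fin (m+1) → Fin (m+2)) : Fin (m+2) → Fin (m+2)) •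
          (M (f j) d * XX ξ (Function.update f j d)) =
        ∑ f : Fin m → Fin (m+2), ∑ e,
        eps (Fin.cons a (Fin.cons b (Function.update f j e) : Fin (m+1) → Fin (m+2)) :
          Fin (m+2) → Fin (m+2)) • (M e (f j) * XX ξ f) := by
      intro j
      rw [sum_update j]
      simp
    rw [Finset.sum_congr rfl fun j _ => h1 j, Finset.sum_comm]
    refine Finset.sum_congr rfl fun f _ => ?_
    have h3 := eps_invariant M
      (Fin.cons a (Fin.cons b f : Fin (m+1) → Fin (m+2)) : Fin (m+2) → Fin (m+2))
    rw [htr, smul_zero, Fin.sum_univ_succ, Fin.sum_univ_succ (n := m)] at h3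
    simp only [Fin.cons_zero, Fin.cons_succ, Fin.update_cons_zero, ← Fin.cons_update] at h3
    rw [← add_assoc] at h3
    rw [← eq_neg_of_add_eq_zero_right h3]
    simp [Finset.sum_mul]
  simp only [Vtwo_eq]
  simp only [smul_mul_assoc, Finset.sum_mul, map_smul, map_sum,
    q_XX ξ M q hM hq, smul_add, Finset.sum_add_distrib]
  congr 1
  · have := congrArg (fun z => ((Nat.factorial m : ℝ))⁻¹ • (z * y)) key
    simp only [Finset.sum_mul, smul_mul_assoc] at this
    simp only [← Finset.smul_sum, ← Finset.sum_mul] at this ⊢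
    rw [this, ← smul_mul_assoc]
    congr 1
    simp only [neg_mul, add_mul, Finset.sum_neg_distrib, Finset.sum_add_distrib, smul_neg,
      smul_add, Finset.sum_mul, Finset.smul_sum, Finset.mul_sum, mul_smul_comm, smul_mul_assoc]
    rw [Finset.sum_comm]
    congr 2
    rw [Finset.sum_comm]
  · simp only [Finset.smul_sum, smul_smul]
    refine Finset.sum_congr rfl fun f _ => ?_
    congr 1; ring

theorem V_theta {m : ℕ} {A : Type*} [Ring A] [Algebra ℝ A] (ξ : Fin (m+2) → A)
    (M : Fin (m+2) → Fin (m+2) → A)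
    (hξξ : ∀ a b, ξ a * ξ b = - (ξ b * ξ a))
    (hM : ∀ x a d, ξ x * M a d = - (M a d * ξ x))
    (htr : ∑ a, M a a = 0) :
    ∑ a, ∑ b, Vtwo ξ a b * ((∑ d, M a d * ξ d) * ξ b) = 0 := by
  let T : Fin (m+2) → A := fun i => ∑ h : Fin (m+2) → Fin (m+2), ∑ e,
    (eps (Function.update h i e) • M e (h i)) * XX ξ h
  have hT : ∑ i, T i = 0 := by
    simp only [T]
    rw [Finset.sum_comm]
    refine Finset.sum_eq_zero fun h _ => ?_
    simp only [← Finset.sum_mul]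
    rw [eps_invariant, htr]; simp
  have hTi : ∀ i, T i = T 0 := by
    intro i
    by_cases hi : i = 0
    · rw [hi]
    refine Fintype.sum_equiv (Equiv.arrowCongr (Equiv.swap i 0) (Equiv.refl _)) _ _ fun h => ?_
    have e1 : (Equiv.arrowCongr (Equiv.swap i 0) (Equiv.refl (Fin (m+2)))) h
        = h ∘ Equiv.swap i 0 := by
      funext x; simp [Equiv.arrowCongr]
    rw [e1]
    refine Finset.sum_congr rfl fun e _ => ?_
    have e2 : Function.update (h ∘ Equiv.swap i 0) 0 e
        = Function.update h i e ∘ Equiv.swap i 0 := by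
      funext x
      by_cases hx : x = 0
      · subst hx; simp
      · have : Equiv.swap i 0 x ≠ i := by
          intro hh
          apply hx
          have := congrArg (Equiv.swap i 0) hh
          simpa using this
        simp [hx, this]
    rw [e2, eps_swap _ hi, XX_swap ξ hξξ _ hi]
    simp
  have hT0 : T 0 = 0 := by
    rw [Finset.sum_congr rfl fun i _ => hTi i] at hT
    simp only [Finset.sum_const, Finset.card_univ, Fintype.card_fin] at hT
    have h2 : ((m+2 : ℕ) : ℝ) • T 0 = 0 := by rw [Nat.cast_smul_eq_nsmul]; exact hT
    exact (smul_eq_zero.mp h2).resolve_left (by positivity)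
  have hX : ∀ (f : Fin m → Fin (m+2)) c b, XX ξ f * (ξ c * ξ b) = ξ c * (ξ b * XX ξ f) := by
    intro f c b
    rw [M_XX ξ (ξ b) (fun x => hξξ x b), mul_smul_comm, ← mul_assoc (ξ c),
      M_XX ξ (ξ c) (fun x => hξξ x c), smul_mul_assoc, smul_smul, ← mul_pow]
    simp [mul_assoc]
  have hterm : ∀ a b, Vtwo ξ a b * ((∑ d, M a d * ξ d) * ξ b) =
      ((-1:ℝ)^m * ((Nat.factorial m : ℝ))⁻¹) • ∑ d, ∑ f : Fin m → Fin (m+2),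
        (eps (Fin.cons a (Fin.cons b f : Fin (m+1) → Fin (m+2)) : Fin (m+2) → Fin (m+2)) • M a d) *
        XX ξ (Fin.cons d (Fin.cons b f : Fin (m+1) → Fin (m+2)) : Fin (m+2) → Fin (m+2)) := by
    intro a b
    rw [Finset.sum_mul, Finset.mul_sum, Finset.smul_sum]
    refine Finset.sum_congr rfl fun d _ => ?_
    have hc : Vtwo ξ a b * M a d = ((-1:ℝ)^m) • (M a d * Vtwo ξ a b) := by
      rw [M_V ξ (M a d) (fun x => hM x a d), smul_smul, ← mul_pow]; simp
    rw [mul_assoc (M a d), ← mul_assoc, hc, Vtwo_eq]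
    simp only [smul_mul_assoc, mul_smul_comm, Finset.mul_sum, Finset.sum_mul, Finset.smul_sum,
      mul_assoc, hX, XX_cons, smul_smul]
  simp only [hterm, ← Finset.smul_sum]
  have : T 0 = ∑ a, ∑ b, ∑ d, ∑ f : Fin m → Fin (m+2),
        (eps (Fin.cons a (Fin.cons b f : Fin (m+1) → Fin (m+2)) : Fin (m+2) → Fin (m+2)) • M a d) *
        XX ξ (Fin.cons d (Fin.cons b f : Fin (m+1) → Fin (m+2)) : Fin (m+2) → Fin (m+2)) := by
    simp only [T]
    rw [Finset.sum_comm]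
    refine Finset.sum_congr rfl fun a _ => ?_
    rw [sum_cons, Finset.sum_comm' (t' := Finset.univ) (s' := fun _ => Finset.univ) (by simp)]
    rw [sum_cons]
    simp only [Fin.cons_zero, Fin.update_cons_zero]
    refine Finset.sum_congr rfl fun b _ => ?_
    rw [Finset.sum_comm]
  rw [← this, hT0, smul_zero]

/-- the Hamiltonian
`𝓗 = 𝒱_{ab}(ξ)(ρ^a{}_c ρ^{cb} + ((n-2)λ/n) ξ^a ξ^b)` is annihilated by the
Chevalley-Eilenberg differential `q`: `q 𝓗 = 0`. Here `q` is the odd derivation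
of the free graded-commutative algebra on odd `ξ^a`, `ρ^{ab} = -ρ^{ba}` with
`q ξ^a = ρ^a{}_b ξ^b`, `q ρ^{ab} = ρ^a{}_c ρ^{cb} + λ ξ^a ξ^b` (indices moved
with the symmetric form `η`). -/
theorem q_annihilates_H
    (n : ℕ) (hn : 3 ≤ n) (lam : ℝ) (A : Type*) [Ring A] [Algebra ℝ A]
    (η : Fin n → Fin n → ℝ) (hη : ∀ a b, η a b = η b a)
    (ξ : Fin n → A) (ρ : Fin n → Fin n → A)
    (hρa : ∀ a b, ρ a b = - ρ b a)
    (hξξ : ∀ a b, ξ a * ξ b = - (ξ b * ξ a))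
    (hξρ : ∀ a b c, ξ a * ρ b c = - (ρ b c * ξ a))
    (hρρ : ∀ a b c d, ρ a b * ρ c d = - (ρ c d * ρ a b))
    (qξ : Fin n → A) (qρ : Fin n → Fin n → A)
    (hqξ : ∀ a, qξ a = ∑ b, ∑ c, η c b • (ρ a c * ξ b))
    (hqρ : ∀ a b, qρ a b =
      (∑ c, ∑ d, η c d • (ρ a c * ρ d b)) + lam • (ξ a * ξ b))
    (q : A →ₗ[ℝ] A)
    (hqgenξ : ∀ a, q (ξ a) = qξ a)
    (hqgenρ : ∀ a b, q (ρ a b) = qρ a b)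
    (hqLξ : ∀ a x, q (ξ a * x) = qξ a * x - ξ a * q x)
    (hqLρ : ∀ a b x, q (ρ a b * x) = qρ a b * x - ρ a b * q x) :
    q (∑ a, ∑ b, Vtwo ξ a b *
        ((∑ c, ∑ e, η c e • (ρ a c * ρ e b))
          + (((n : ℝ) - 2) * lam / (n : ℝ)) • (ξ a * ξ b))) = 0 := by

  obtain ⟨m, rfl⟩ : ∃ m, n = m + 2 := ⟨n - 2, by omega⟩
  obtain ⟨k, hk⟩ : ∃ k : ℝ, k = (((m + 2 : ℕ) : ℝ) - 2) * lam / ((m + 2 : ℕ) : ℝ) := ⟨_, rfl⟩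
  rw [← hk]
  let M : Fin (m+2) → Fin (m+2) → A := fun a d => ∑ c, η c d • ρ a c
  let θ : Fin (m+2) → A := fun a => ∑ d, M a d * ξ d
  let R : Fin (m+2) → Fin (m+2) → A := fun a b => ∑ c, ∑ e, η c e • (ρ a c * ρ e b)
  let S : Fin (m+2) → Fin (m+2) → A := fun a b => ∑ c, M a c * R c b
  have hM : ∀ x a d, ξ x * M a d = - (M a d * ξ x) := by
    intro x a d
    simp only [M, Finset.mul_sum, Finset.sum_mul, ← Finset.sum_neg_distrib]
    refine Finset.sum_congr rfl fun c _ => ?_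
    rw [mul_smul_comm, hξρ, smul_mul_assoc, smul_neg]
  have htr : ∑ a, M a a = 0 := by
    have h1 : ∑ a, M a a = - ∑ a, M a a := by
      simp only [M]
      conv_rhs => rw [Finset.sum_comm]
      simp only [← Finset.sum_neg_distrib]
      refine Finset.sum_congr rfl fun a _ => Finset.sum_congr rfl fun c _ => ?_
      rw [hρa a c, hη c a, smul_neg]
    have h2 : (2:ℝ) • (∑ a, M a a) = 0 := by
      rw [two_smul]
      nth_rewrite 1 [h1]
      simp
    simpa using h2
  have hqθ : ∀ a, qξ a = θ a := by
    intro a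
    rw [hqξ]
    simp only [θ, M, Finset.sum_mul, smul_mul_assoc]
  have hq : ∀ a x, q (ξ a * x) = (∑ d, M a d * ξ d) * x - ξ a * q x := by
    intro a x
    rw [hqLξ, hqθ]
  have hξθ : ∀ a b, ξ a * θ b = θ b * ξ a := by
    intro a b
    simp only [θ, Finset.mul_sum, Finset.sum_mul]
    refine Finset.sum_congr rfl fun d _ => ?_
    rw [← mul_assoc, hM, neg_mul, mul_assoc, hξξ a d, mul_assoc]
    simp
  have hRa : ∀ a b, R a b = - R b a := by
    intro a b
    simp only [R]
    conv_rhs => rw [Finset.sum_comm]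
    simp only [← Finset.sum_neg_distrib]
    refine Finset.sum_congr rfl fun c _ => Finset.sum_congr rfl fun e _ => ?_
    rw [hρρ, hρa a c, hρa e b, hη c e]
    simp
  have hS : ∀ a b, S a b = ∑ d, ∑ c, ∑ f, ∑ e,
      (η d c * η f e) • (ρ a d * (ρ c f * ρ e b)) := by
    intro a b
    simp only [S, M, Finset.sum_mul]
    rw [Finset.sum_comm]
    simp only [R, Finset.mul_sum]
    refine Finset.sum_congr rfl fun d _ => Finset.sum_congr rfl fun c _ =>
      Finset.sum_congr rfl fun f _ => Finset.sum_congr rfl fun e _ => ?_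
    rw [smul_mul_smul_comm]
  have hSs : ∀ a b, S a b = S b a := by
    intro a b
    rw [hS, hS]
    have hrev : ∀ d c f e, ρ a d * (ρ c f * ρ e b) = ρ b e * (ρ f c * ρ d a) := by
      intro d c f e
      rw [hρρ c f e b, mul_neg, ← mul_assoc, hρρ a d e b, neg_mul, mul_assoc, hρρ a d c f,
        hρa b e, hρa f c, hρa d a]
      simp
    have h4 : ∀ G : Fin (m+2) → Fin (m+2) → Fin (m+2) → Fin (m+2) → A,
        ∑ d, ∑ c, ∑ f, ∑ e, G d c f e = ∑ d, ∑ c, ∑ f, ∑ e, G e f c d := by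
      intro G
      simp only [← Fintype.sum_prod_type']
      exact Fintype.sum_equiv
        ⟨fun p => (p.2.2.2, p.2.2.1, p.2.1, p.1), fun p => (p.2.2.2, p.2.2.1, p.2.1, p.1),
          fun _ => rfl, fun _ => rfl⟩ _ _ fun p => rfl
    rw [h4]
    refine Finset.sum_congr rfl fun d _ => Finset.sum_congr rfl fun c _ =>
      Finset.sum_congr rfl fun f _ => Finset.sum_congr rfl fun e _ => ?_
    rw [hrev, hη e f, hη c d, mul_comm]
  have hRρ : ∀ a b, ∑ c, ∑ e, η c e • (R a c * ρ e b) = S a b := by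
    intro a b
    rw [hS]
    have h4 : ∀ G : Fin (m+2) → Fin (m+2) → Fin (m+2) → Fin (m+2) → A,
        ∑ d, ∑ c, ∑ f, ∑ e, G d c f e = ∑ d, ∑ c, ∑ f, ∑ e, G f e d c := by
      intro G
      simp only [← Fintype.sum_prod_type']
      exact Fintype.sum_equiv
        ⟨fun p => (p.2.2.1, p.2.2.2, p.1, p.2.1), fun p => (p.2.2.1, p.2.2.2, p.1, p.2.1),
          fun _ => rfl, fun _ => rfl⟩ _ _ fun p => rfl
    rw [h4]
    simp only [R, Finset.sum_mul, Finset.smul_sum]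
    refine Finset.sum_congr rfl fun d _ => Finset.sum_congr rfl fun c _ =>
      Finset.sum_congr rfl fun f _ => Finset.sum_congr rfl fun e _ => ?_
    rw [smul_mul_assoc, smul_smul, mul_assoc, mul_comm]
  have hρR : ∀ a b, ∑ c, ∑ e, η c e • (ρ a c * R e b) = S a b := by
    intro a b
    simp only [S, M, Finset.sum_mul]
    rw [Finset.sum_comm]
    simp only [smul_mul_assoc]
  have hξξρ : ∀ a b, ∑ c, ∑ e, η c e • (ξ a * ξ c * ρ e b) = ξ a * θ b := by
    intro a b
    simp only [θ, M, Finset.sum_mul, Finset.mul_sum]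
    refine Finset.sum_congr rfl fun c _ => Finset.sum_congr rfl fun e _ => ?_
    rw [smul_mul_assoc, mul_smul_comm, mul_assoc, hξρ, hρa e b, hη c e]
    simp
  have hρξξ : ∀ a b, ∑ c, ∑ e, η c e • (ρ a c * (ξ e * ξ b)) = θ a * ξ b := by
    intro a b
    simp only [θ, M, Finset.sum_mul, Finset.mul_sum]
    rw [Finset.sum_comm]
    refine Finset.sum_congr rfl fun c _ => Finset.sum_congr rfl fun e _ => ?_
    rw [smul_mul_assoc, smul_mul_assoc, mul_assoc]
  have hqR : ∀ a b, q (R a b) = lam • (ξ a * θ b) - lam • (θ a * ξ b) := by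
    intro a b
    have h1 : q (R a b) = ∑ c, ∑ e, (η c e • (R a c * ρ e b) + lam • η c e • (ξ a * ξ c * ρ e b)
        - η c e • (ρ a c * R e b) - lam • η c e • (ρ a c * (ξ e * ξ b))) := by
      simp only [R, map_sum, map_smul]
      refine Finset.sum_congr rfl fun c _ => Finset.sum_congr rfl fun e _ => ?_
      rw [hqLρ, hqgenρ, hqρ, hqρ, add_mul, mul_add, smul_mul_assoc, mul_smul_comm]
      module
    rw [h1]
    simp only [Finset.sum_sub_distrib, Finset.sum_add_distrib, ← Finset.smul_sum]
    rw [hRρ, hξξρ, hρR, hρξξ]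
    abel
  have hqξξ : ∀ a b, q (ξ a * ξ b) = θ a * ξ b - ξ a * θ b := by
    intro a b
    rw [hqLξ, hqgenξ, hqθ, hqθ]
  let Y : Fin (m+2) → Fin (m+2) → A := fun a b => R a b + k • (ξ a * ξ b)
  have hMY1 : ∀ a b, ∑ c, M a c * Y c b = S a b + k • (θ a * ξ b) := by
    intro a b
    simp only [Y, mul_add, Finset.sum_add_distrib, S, θ, Finset.sum_mul, Finset.smul_sum,
      mul_smul_comm, mul_assoc]
  have hMY2 : ∀ a b, ∑ c, M b c * Y a c = - S b a - k • (ξ a * θ b) := by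
    intro a b
    simp only [Y, mul_add, Finset.sum_add_distrib, S, θ, Finset.mul_sum, Finset.smul_sum,
      sub_eq_add_neg, ← Finset.sum_neg_distrib]
    congr 1
    · refine Finset.sum_congr rfl fun c _ => ?_
      rw [hRa a c, mul_neg]
    · refine Finset.sum_congr rfl fun c _ => ?_
      rw [mul_smul_comm, ← mul_assoc, ← mul_assoc, hM, neg_mul, smul_neg, neg_neg]
  have hZ : ∀ a b, q (Y a b) - ∑ c, M a c * Y c b - ∑ c, M b c * Y a c
      = lam • (θ b * ξ a) - lam • (θ a * ξ b) := by
    intro a b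
    rw [hMY1, hMY2, hSs b a]
    simp only [Y, map_add, map_smul]
    rw [hqR, hqξξ, hξθ]
    module
  have hVθ : ∑ a, ∑ b, Vtwo ξ a b * (θ a * ξ b) = 0 := V_theta ξ M hξξ hM htr
  have hVθ' : ∑ a, ∑ b, Vtwo ξ a b * (θ b * ξ a) = 0 := by
    rw [Finset.sum_comm, ← neg_eq_zero, ← hVθ]
    simp only [← Finset.sum_neg_distrib]
    refine Finset.sum_congr rfl fun a _ => Finset.sum_congr rfl fun b _ => ?_
    rw [Vtwo_antisymm ξ b a, neg_mul, neg_neg]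
  have hA : ∑ a, ∑ b, (∑ e, M e a * Vtwo ξ e b) * Y a b =
      ((-1:ℝ)^m) • ∑ a, ∑ b, Vtwo ξ a b * ∑ c, M a c * Y c b := by
    simp only [Finset.sum_mul, Finset.mul_sum, Finset.smul_sum]
    have h3 : ∀ G : Fin (m+2) → Fin (m+2) → Fin (m+2) → A,
        ∑ a, ∑ b, ∑ e, G a b e = ∑ a, ∑ b, ∑ e, G e b a := by
      intro G
      simp only [← Fintype.sum_prod_type']
      exact Fintype.sum_equiv
        ⟨fun p => (p.2.2, p.2.1, p.1), fun p => (p.2.2, p.2.1, p.1),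
          fun _ => rfl, fun _ => rfl⟩ _ _ fun p => rfl
    rw [h3]
    refine Finset.sum_congr rfl fun a _ => Finset.sum_congr rfl fun b _ =>
      Finset.sum_congr rfl fun c _ => ?_
    rw [M_V ξ _ (fun x => hM x _ _), smul_mul_assoc, mul_assoc]
  have hB : ∑ a, ∑ b, (∑ e, M e b * Vtwo ξ a e) * Y a b =
      ((-1:ℝ)^m) • ∑ a, ∑ b, Vtwo ξ a b * ∑ c, M b c * Y a c := by
    simp only [Finset.sum_mul, Finset.mul_sum, Finset.smul_sum]
    refine Finset.sum_congr rfl fun a _ => ?_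
    rw [Finset.sum_comm]
    refine Finset.sum_congr rfl fun b _ =>
      Finset.sum_congr rfl fun c _ => ?_
    rw [M_V ξ _ (fun x => hM x _ _), smul_mul_assoc, mul_assoc]
  have hmain : q (∑ a, ∑ b, Vtwo ξ a b * Y a b) = ((-1:ℝ)^m) • ∑ a, ∑ b, Vtwo ξ a b *
      (q (Y a b) - ∑ c, M a c * Y c b - ∑ c, M b c * Y a c) := by
    simp only [map_sum, q_V ξ M q hM htr hq, mul_sub, neg_mul, add_mul, Finset.sum_add_distrib,
      Finset.sum_sub_distrib, Finset.sum_neg_distrib, smul_sub, ← Finset.smul_sum]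
    rw [hA, hB]
    abel
  change q (∑ a, ∑ b, Vtwo ξ a b * Y a b) = 0
  rw [hmain]
  simp only [hZ, mul_sub, mul_smul_comm, Finset.sum_sub_distrib, ← Finset.smul_sum]
  rw [hVθ, hVθ']
  simp
end

section
/- Double contraction of ω with q vanishes: ι_q ι_q ω = 0 for ω = 𝒱_{abc}(ξ) dξ^a ∧ dρ^{bc} and the Chevalley-Eilenberg vector field q. -/
open scoped BigOperators

def cat3 {n : ℕ} (a b c : Fin n) (f : Fin (n - 3) → Fin n) : Fin n → Fin n :=
  fun i =>
    if i.val = 0 then a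
    else if i.val = 1 then b
    else if i.val = 2 then c
    else if h : i.val - 3 < n - 3 then f ⟨i.val - 3, h⟩ else a

noncomputable def Vthree {n : ℕ} {A : Type*} [Ring A] [Algebra ℝ A]
    (ξ : Fin n → A) (a b c : Fin n) : A :=
  ((Nat.factorial (n - 3) : ℝ))⁻¹ •
    ∑ f : Fin (n - 3) → Fin n,
      eps (cat3 a b c f) • (List.ofFn fun j => ξ (f j)).prod

theorem mod2 {N : ℕ} : 2 % (N + 3) = 2 := Nat.mod_eq_of_lt (by omega)

theorem mod2a {N : ℕ} : 2 % (N + 1 + 1 + 1) = 2 := Nat.mod_eq_of_lt (by omega)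

def Lp {n m : ℕ} {A : Type*} [Ring A] (ξ : Fin n → A) (g : Fin m → Fin n) : A :=
  (List.ofFn fun j => ξ (g j)).prod

theorem self_neg_zero {A : Type*} [Ring A] [Algebra ℝ A] {x : A} (h : x = -x) : x = 0 := by
  have h2 : (2 : ℝ) • x = 0 := by
    rw [two_smul]; nth_rewrite 2 [h]; simp
  exact (smul_eq_zero_iff_right (by norm_num : (2:ℝ) ≠ 0)).1 h2

theorem Lp_alt {n : ℕ} {A : Type*} [Ring A] [Algebra ℝ A] (ξ : Fin n → A)
    (hξξ : ∀ a b, ξ a * ξ b = - (ξ b * ξ a)) (m : ℕ) :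
    ∃ M : (Fin n → ℝ) [⋀^Fin m]→ₗ[ℝ] A, ∀ g : Fin m → Fin n,
      Lp ξ g = M (fun j => Pi.single (g j) 1) := by
  let φ : (Fin n → ℝ) →ₗ[ℝ] A := Fintype.linearCombination ℝ ξ
  have hφ : ∀ v, φ v * φ v = 0 := by
    intro v
    apply self_neg_zero
    simp only [φ, Fintype.linearCombination_apply, Finset.sum_mul_sum]
    conv_rhs => rw [Finset.sum_comm]
    rw [← Finset.sum_neg_distrib]
    refine Finset.sum_congr rfl fun i _ => ?_
    rw [← Finset.sum_neg_distrib]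
    refine Finset.sum_congr rfl fun j _ => ?_
    rw [smul_mul_smul_comm, smul_mul_smul_comm, hξξ i j, smul_neg, mul_comm]
  let Φ := ExteriorAlgebra.lift ℝ ⟨φ, hφ⟩
  refine ⟨Φ.toLinearMap.compAlternatingMap (ExteriorAlgebra.ιMulti ℝ m), fun g => ?_⟩
  simp only [LinearMap.compAlternatingMap_apply, ExteriorAlgebra.ιMulti_apply,
    AlgHom.toLinearMap_apply, map_list_prod, List.map_ofFn, Lp]
  congr 2
  funext j
  simp [Φ, φ, Fintype.linearCombination_apply_single]

theorem Lp_swap {n m : ℕ} {A : Type*} [Ring A] [Algebra ℝ A] (ξ : Fin n → A)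
    (hξξ : ∀ a b, ξ a * ξ b = - (ξ b * ξ a)) (g : Fin m → Fin n) {i j : Fin m} (h : i ≠ j) :
    Lp ξ (g ∘ Equiv.swap i j) = - Lp ξ g := by
  obtain ⟨M, hM⟩ := Lp_alt ξ hξξ m
  rw [hM, hM, ← M.map_swap _ h]
  rfl

theorem Lp_zero {n m : ℕ} {A : Type*} [Ring A] [Algebra ℝ A] (ξ : Fin n → A)
    (hξξ : ∀ a b, ξ a * ξ b = - (ξ b * ξ a)) (g : Fin m → Fin n) {i j : Fin m} (h : i ≠ j)
    (hg : g i = g j) : Lp ξ g = 0 := by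
  obtain ⟨M, hM⟩ := Lp_alt ξ hξξ m
  rw [hM]
  exact M.map_eq_zero_of_eq _ (by simp [hg]) h

theorem Lp_snoc {n m : ℕ} {A : Type*} [Ring A] (ξ : Fin n → A) (g : Fin (m+1) → Fin n) :
    Lp ξ g = Lp ξ (fun j : Fin m => g j.castSucc) * ξ (g (Fin.last m)) := by
  simp only [Lp]
  rw [List.ofFn_succ']
  simp

noncomputable def sg {n : ℕ} (σ : Equiv.Perm (Fin n)) : ℝ := ((Equiv.Perm.sign σ : ℤ) : ℝ)

theorem avg {n m : ℕ} {A : Type*} [Ring A] [Algebra ℝ A] (ξ : Fin n → A)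
    (hξξ : ∀ a b, ξ a * ξ b = - (ξ b * ξ a)) (p : Fin m → Fin n) (hp : Function.Injective p)
    (i0 : Fin m) (F : Fin n → Equiv.Perm (Fin n) → A)
    (hF : ∀ k σ i, F k (σ * Equiv.swap (p i) (p i0)) = F k σ) :
    (m : ℝ) • ∑ σ, sg σ • (Lp ξ (σ ∘ p) * F (σ (p i0)) σ)
      = ∑ σ, sg σ • (Lp ξ (σ ∘ p) * ∑ i, F (σ (p i)) σ) := by
  simp only [Finset.mul_sum, Finset.smul_sum]
  rw [Finset.sum_comm (s := Finset.univ (α := Equiv.Perm (Fin n)))]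
  have : ∀ i, ∑ σ, sg σ • (Lp ξ (σ ∘ p) * F (σ (p i)) σ)
      = ∑ σ, sg σ • (Lp ξ (σ ∘ p) * F (σ (p i0)) σ) := by
    intro i
    by_cases hi : i = i0
    · rw [hi]
    rw [← Equiv.sum_comp (Equiv.mulRight (Equiv.swap (p i) (p i0)))]
    refine Finset.sum_congr rfl fun σ _ => ?_
    have e1 : (⇑(σ * Equiv.swap (p i) (p i0)) ∘ p) = (σ ∘ p) ∘ Equiv.swap i i0 := by
      funext j
      simp [hp.map_swap]
    have e2 : sg (σ * Equiv.swap (p i) (p i0)) = - sg σ := by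
      simp [sg, Equiv.Perm.sign_mul, Equiv.Perm.sign_swap (hp.ne hi)]
    rw [Equiv.coe_mulRight, e1, e2, Lp_swap ξ hξξ _ hi, hF]
    simp
  simp only [this, Finset.sum_const, Finset.card_univ, Fintype.card_fin]
  rw [← Finset.smul_sum, Nat.cast_smul_eq_nsmul]

theorem cat3_iff {N : ℕ} (g : Fin (N+3) → Fin (N+3)) (a b c : Fin (N+3))
    (f : Fin N → Fin (N+3)) :
    g = cat3 a b c f ↔ a = g 0 ∧ b = g 1 ∧ c = g 2 ∧ f = fun j => g j.succ.succ.succ := by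
  constructor
  · rintro rfl
    refine ⟨by simp [cat3], by simp [cat3], ?_, ?_⟩
    · simp [cat3, mod2, mod2a]
    · funext j
      simp [cat3]
  · rintro ⟨rfl, rfl, rfl, rfl⟩
    funext i
    refine Fin.cases ?_ (fun i => Fin.cases ?_ (fun i => Fin.cases ?_ (fun i => ?_) i) i) i
    · simp [cat3]
    · simp [cat3]
    · simp [cat3]; rfl
    · simp [cat3]

theorem V_sum {N : ℕ} {A : Type*} [Ring A] [Algebra ℝ A] (ξ : Fin (N+3) → A)
    (X : Fin (N+3) → Fin (N+3) → Fin (N+3) → A) :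
    ∑ a, ∑ b, ∑ c, Vthree ξ a b c * X a b c =
      ((Nat.factorial N : ℝ))⁻¹ • ∑ σ : Equiv.Perm (Fin (N+3)),
        sg σ • (Lp ξ (fun j : Fin N => σ j.succ.succ.succ) * X (σ 0) (σ 1) (σ 2)) := by
  have key : ∀ σ : Equiv.Perm (Fin (N+3)),
      sg σ • (Lp ξ (fun j : Fin N => σ j.succ.succ.succ) * X (σ 0) (σ 1) (σ 2)) =
      ∑ a, ∑ b, ∑ c, ∑ f : Fin N → Fin (N+3),
        (if (σ : Fin (N+3) → Fin (N+3)) = cat3 a b c f then sg σ else 0) •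
          (Lp ξ f * X a b c) := by
    intro σ
    simp only [cat3_iff, ite_and, ite_smul, zero_smul]
    simp [Finset.sum_ite_eq', Finset.sum_ite_irrel]
  simp only [key]
  rw [Finset.sum_comm (s := Finset.univ (α := Equiv.Perm (Fin (N+3)))), Finset.smul_sum]
  refine Finset.sum_congr rfl fun a _ => ?_
  rw [Finset.sum_comm (s := Finset.univ (α := Equiv.Perm (Fin (N+3)))), Finset.smul_sum]
  refine Finset.sum_congr rfl fun b _ => ?_
  rw [Finset.sum_comm (s := Finset.univ (α := Equiv.Perm (Fin (N+3)))), Finset.smul_sum]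
  refine Finset.sum_congr rfl fun c _ => ?_
  rw [Finset.sum_comm (s := Finset.univ (α := Equiv.Perm (Fin (N+3))))]
  unfold Vthree
  rw [smul_mul_assoc, Finset.sum_mul]
  congr 1
  refine Finset.sum_congr rfl fun f _ => ?_
  rw [smul_mul_assoc, eps, Finset.sum_smul]
  rfl

def p0 {N : ℕ} (j : Fin (N+1)) : Fin (N+3) :=
  if h : j.val < N then ⟨j.val + 3, by omega⟩ else 0

def p3 {N : ℕ} (j : Fin (N+3)) : Fin (N+3) :=
  if h : j.val < N then ⟨j.val + 3, by omega⟩ else ⟨j.val - N, by omega⟩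

theorem p0_inj {N : ℕ} : Function.Injective (p0 (N := N)) := by
  intro i j h
  have := congrArg Fin.val h
  unfold p0 at this
  ext
  split_ifs at this <;> simp at this <;> omega

theorem p3_inj {N : ℕ} : Function.Injective (p3 (N := N)) := by
  intro i j h
  have := congrArg Fin.val h
  unfold p3 at this
  ext
  split_ifs at this <;> simp at this <;> omega

theorem p0_cast {N : ℕ} (j : Fin N) : p0 j.castSucc = j.succ.succ.succ := by
  ext; simp [p0]

theorem p0_last {N : ℕ} : p0 (Fin.last N) = 0 := by
  ext; simp [p0]

/-- first part: the term with one `ξ`. -/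
theorem term_one {N : ℕ} {A : Type*} [Ring A] [Algebra ℝ A] (ξ : Fin (N+3) → A)
    (hξξ : ∀ a b, ξ a * ξ b = - (ξ b * ξ a))
    (T : Fin (N+3) → Fin (N+3) → Fin (N+3) → Fin (N+3) → A)
    (hY : ∀ b c, ∑ k, (T k b c k - T b k c k - T c b k k) = 0)
    (hT : ∀ a b d, T a b b d = 0) :
    ∑ a, ∑ b, ∑ c, Vthree ξ a b c * (∑ d, ξ d * T a b c d) = 0 := by
  rw [V_sum]
  have hP : ∀ (σ : Equiv.Perm (Fin (N+3))) (k : Fin (N+3)),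
      Lp ξ (fun j : Fin N => σ j.succ.succ.succ) * ξ (σ k) =
        Lp ξ (Fin.snoc (α := fun _ => Fin (N+3)) (fun j : Fin N => σ j.succ.succ.succ) (σ k)) := by
    intro σ k
    rw [Lp_snoc]; simp
  have hz : ∀ (σ : Equiv.Perm (Fin (N+3))) (j : Fin N),
      Lp ξ (fun j : Fin N => σ j.succ.succ.succ) * ξ (σ j.succ.succ.succ) = 0 := by
    intro σ j
    rw [hP]
    apply Lp_zero ξ hξξ _ (Fin.castSucc_lt_last j).ne
    simp
  have h0 : ∀ (σ : Equiv.Perm (Fin (N+3))),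
      Lp ξ (fun j : Fin N => σ j.succ.succ.succ) * ξ (σ 0) = Lp ξ (σ ∘ p0) := by
    intro σ
    rw [Lp_snoc ξ (σ ∘ p0)]
    simp [p0_cast, p0_last]
  have e1 : ∀ σ : Equiv.Perm (Fin (N+3)),
      sg σ • (Lp ξ (fun j : Fin N => σ j.succ.succ.succ) *
        (∑ d, ξ d * T (σ 0) (σ 1) (σ 2) d)) =
      sg σ • (Lp ξ (σ ∘ p0) * T (σ 0) (σ 1) (σ 2) (σ 0))
      + sg σ • (Lp ξ (fun j : Fin N => σ j.succ.succ.succ) * ξ (σ 1) *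
            T (σ 0) (σ 1) (σ 2) (σ 1))
      + sg σ • (Lp ξ (fun j : Fin N => σ j.succ.succ.succ) * ξ (σ 2) *
            T (σ 0) (σ 1) (σ 2) (σ 2)) := by
    intro σ
    rw [← Equiv.sum_comp σ, Finset.mul_sum, ← smul_add, ← smul_add]
    congr 1
    simp only [← mul_assoc]
    rw [Fin.sum_univ_succ, Fin.sum_univ_succ, Fin.sum_univ_succ]
    simp only [hz, h0]
    simp [add_assoc]
  have sw : ∀ (k : Fin (N+3)), k = 1 ∨ k = 2 → ∀ (G : Equiv.Perm (Fin (N+3)) → A),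
      ∑ σ : Equiv.Perm (Fin (N+3)), sg σ • (Lp ξ (fun j : Fin N => σ j.succ.succ.succ) *
        ξ (σ k) * G σ) = ∑ σ : Equiv.Perm (Fin (N+3)),
          sg σ • (Lp ξ (σ ∘ p0) * - G (σ * Equiv.swap 0 k)) := by
    intro k hk G
    have hk0 : (0 : Fin (N+3)) ≠ k := by
      rcases hk with rfl | rfl <;> simp [Fin.ext_iff, mod2, mod2a]
    rw [← Equiv.sum_comp (Equiv.mulRight (Equiv.swap 0 k))]
    refine Finset.sum_congr rfl fun σ _ => ?_
    have e2 : sg (σ * Equiv.swap 0 k) = - sg σ := by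
      simp [sg, Equiv.Perm.sign_mul, Equiv.Perm.sign_swap hk0]
    have e3 : ∀ j : Fin N, (σ * Equiv.swap 0 k) j.succ.succ.succ = σ j.succ.succ.succ := by
      intro j
      rw [Equiv.Perm.mul_apply, Equiv.swap_apply_of_ne_of_ne]
      · simp [Fin.ext_iff]
      · rcases hk with rfl | rfl <;> simp [Fin.ext_iff, mod2, mod2a]
    have e4 : (σ * Equiv.swap 0 k) k = σ 0 := by simp
    simp only [Equiv.coe_mulRight, e2, e3, e4, h0]
    simp
  simp only [e1, Finset.sum_add_distrib]
  rw [sw 1 (Or.inl rfl) (fun σ => T (σ 0) (σ 1) (σ 2) (σ 1)),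
    sw 2 (Or.inr rfl) (fun σ => T (σ 0) (σ 1) (σ 2) (σ 2))]
  have n01 : (0 : Fin (N+3)) ≠ 1 := by simp [Fin.ext_iff]
  have n02 : (0 : Fin (N+3)) ≠ 2 := by simp [Fin.ext_iff, mod2, mod2a]
  have n12 : (1 : Fin (N+3)) ≠ 2 := by simp [Fin.ext_iff, mod2, mod2a]
  simp only [Equiv.Perm.mul_apply, Equiv.swap_apply_left, Equiv.swap_apply_right,
    Equiv.swap_apply_of_ne_of_ne n02.symm n12.symm, Equiv.swap_apply_of_ne_of_ne n01.symm n12]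
  rw [← Finset.sum_add_distrib, ← Finset.sum_add_distrib]
  simp only [← smul_add, ← mul_add]
  have hne : ∀ i : Fin (N+1), p0 i ≠ 1 ∧ p0 i ≠ 2 := by
    intro i
    refine Fin.lastCases ?_ (fun j => ?_) i
    · rw [p0_last]; exact ⟨n01, n02⟩
    · rw [p0_cast]; constructor <;> simp [Fin.ext_iff, mod2, mod2a]
  have hav := avg ξ hξξ p0 p0_inj (Fin.last N)
    (fun k σ => T k (σ 1) (σ 2) k + - T (σ 1) k (σ 2) k + - T (σ 2) (σ 1) k k) (by
      intro k σ i
      simp only [Equiv.Perm.mul_apply,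
        Equiv.swap_apply_of_ne_of_ne (hne i).1.symm (hne (Fin.last N)).1.symm,
        Equiv.swap_apply_of_ne_of_ne (hne i).2.symm (hne (Fin.last N)).2.symm])
  have hr : ∀ σ : Equiv.Perm (Fin (N+3)), ∑ i : Fin (N+1),
      (T (σ (p0 i)) (σ 1) (σ 2) (σ (p0 i)) + - T (σ 1) (σ (p0 i)) (σ 2) (σ (p0 i))
        + - T (σ 2) (σ 1) (σ (p0 i)) (σ (p0 i))) = 0 := by
    intro σ
    have h := hY (σ 1) (σ 2)
    rw [← Equiv.sum_comp σ, Fin.sum_univ_succ, Fin.sum_univ_succ, Fin.sum_univ_succ] at h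
    rw [Fin.sum_univ_castSucc]
    simp only [p0_cast, p0_last]
    have s1 : (Fin.succ (0 : Fin (N+2))) = 1 := rfl
    have s2 : (Fin.succ (Fin.succ (0 : Fin (N+1)))) = 2 := rfl
    simp only [s1, s2, hT] at h
    simp only [← sub_eq_add_neg]
    rw [← h]
    abel
  simp only [hr, mul_zero, smul_zero, Finset.sum_const_zero, p0_last] at hav
  have hav2 := (smul_eq_zero_iff_right (by positivity : ((N+1 : ℕ):ℝ) ≠ 0)).1 hav
  rw [hav2, smul_zero]

/-- second part: the term with three `ξ`. -/
theorem term_three {N : ℕ} {A : Type*} [Ring A] [Algebra ℝ A] (ξ : Fin (N+3) → A)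
    (hξξ : ∀ a b, ξ a * ξ b = - (ξ b * ξ a))
    (r : Fin (N+3) → Fin (N+3) → A) (hr : ∑ k, r k k = 0) :
    ∑ a, ∑ b, ∑ c, Vthree ξ a b c * (∑ d, ξ d * ξ b * ξ c * r a d) = 0 := by
  rw [V_sum]
  have hP : ∀ (σ : Equiv.Perm (Fin (N+3))) (k : Fin (N+3)),
      Lp ξ (fun j : Fin N => σ j.succ.succ.succ) * (ξ (σ k) * ξ (σ 1) * ξ (σ 2)) =
        Lp ξ (fun j : Fin (N+3) => if j.val = N then σ k else σ (p3 j)) := by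
    intro σ k
    rw [Lp_snoc, Lp_snoc, Lp_snoc]
    have a1 : p3 (Fin.last (N+2)) = 2 := by ext; simp [p3, mod2, mod2a]
    have a2 : p3 (Fin.last (N+1)).castSucc = 1 := by ext; simp [p3]
    have a3 : ∀ j : Fin N, p3 j.castSucc.castSucc.castSucc = j.succ.succ.succ := by
      intro j; ext; simp [p3]
    have a4 : ∀ j : Fin N, j.val ≠ N := fun j => j.isLt.ne
    simp [a1, a2, a3, a4, mul_assoc]
  have hz : ∀ (σ : Equiv.Perm (Fin (N+3))) (k : Fin (N+3)), k ≠ 0 →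
      Lp ξ (fun j : Fin N => σ j.succ.succ.succ) * (ξ (σ k) * ξ (σ 1) * ξ (σ 2)) = 0 := by
    intro σ k hk
    rw [hP]
    obtain ⟨i, hi⟩ := (Finite.injective_iff_surjective.1 (p3_inj (N := N))) k
    have hiN : i.val ≠ N := by
      intro h
      apply hk
      rw [← hi]
      ext
      simp [p3, h]
    apply Lp_zero ξ hξξ _ (i := i) (j := ⟨N, by omega⟩)
    · simpa [Fin.ext_iff] using hiN
    · simp [hiN, hi]
  have p3N : p3 (⟨N, by omega⟩ : Fin (N+3)) = 0 := by ext; simp [p3]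
  have h0 : ∀ σ : Equiv.Perm (Fin (N+3)),
      Lp ξ (fun j : Fin N => σ j.succ.succ.succ) * (ξ (σ 0) * ξ (σ 1) * ξ (σ 2)) =
        Lp ξ (σ ∘ p3) := by
    intro σ
    rw [hP]
    congr 1
    funext j
    by_cases h : j.val = N
    · have : j = ⟨N, by omega⟩ := Fin.ext h
      simp [this, p3N]
    · simp [h]
  have e1 : ∀ σ : Equiv.Perm (Fin (N+3)),
      sg σ • (Lp ξ (fun j : Fin N => σ j.succ.succ.succ) *
        (∑ d, ξ d * ξ (σ 1) * ξ (σ 2) * r (σ 0) d)) =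
      sg σ • (Lp ξ (σ ∘ p3) * r (σ 0) (σ 0)) := by
    intro σ
    rw [← Equiv.sum_comp σ, Finset.mul_sum, Finset.sum_eq_single 0, ← h0]
    · simp only [mul_assoc]
    · intro k _ hk
      rw [← mul_assoc, hz σ k hk, zero_mul]
    · simp
  simp only [e1]
  have hav := avg ξ hξξ p3 p3_inj ⟨N, by omega⟩ (fun k _ => r k k) (fun _ _ _ => rfl)
  have hs : ∀ σ : Equiv.Perm (Fin (N+3)), ∑ i, r (σ (p3 i)) (σ (p3 i)) = 0 := by
    intro σ
    rw [← hr]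
    exact Function.Bijective.sum_comp
      (σ.bijective.comp (Finite.injective_iff_bijective.1 p3_inj)) (fun k => r k k)
  simp only [hs, mul_zero, smul_zero, Finset.sum_const_zero, p3N] at hav
  have hav2 := (smul_eq_zero_iff_right (by positivity : ((N+3 : ℕ):ℝ) ≠ 0)).1 hav
  rw [hav2, smul_zero]

/-- the double contraction of `ω = 𝒱_{abc}(ξ) dξ^a ∧ dρ^{bc}`
with the Chevalley-Eilenberg vector field `q` vanishes: `ι_q ι_q ω = 0`.
The setting is as in Statements 2 and 4. -/
theorem double_contraction_vanishes
    (n : ℕ) (hn : 3 ≤ n) (lam : ℝ) (A : Type*) [Ring A] [Algebra ℝ A]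
    (η : Fin n → Fin n → ℝ) (hη : ∀ a b, η a b = η b a)
    (ξ : Fin n → A) (ρ : Fin n → Fin n → A)
    (Dξ : Fin n → A) (Dρ : Fin n → Fin n → A)
    (hρa : ∀ a b, ρ a b = - ρ b a)
    (hDρa : ∀ a b, Dρ a b = - Dρ b a)
    (hξξ : ∀ a b, ξ a * ξ b = - (ξ b * ξ a))
    (hξρ : ∀ a b c, ξ a * ρ b c = - (ρ b c * ξ a))
    (hρρ : ∀ a b c d, ρ a b * ρ c d = - (ρ c d * ρ a b))
    (hDξc : ∀ a x, Dξ a * x = x * Dξ a)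
    (hDρc : ∀ a b x, Dρ a b * x = x * Dρ a b)
    -- the components of the CE vector field `q`
    (qξ : Fin n → A) (qρ : Fin n → Fin n → A)
    (hqξ : ∀ a, qξ a = ∑ b, ∑ c, η c b • (ρ a c * ξ b))
    (hqρ : ∀ a b, qρ a b =
      (∑ c, ∑ d, η c d • (ρ a c * ρ d b)) + lam • (ξ a * ξ b))
    -- the contraction `ι_q`: an even derivation killing the coordinates and
    -- replacing differentials by the components of `q`
    (ι : A →ₗ[ℝ] A)
    (hιξ : ∀ a, ι (ξ a) = 0)
    (hιρ : ∀ a b, ι (ρ a b) = 0)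
    (hιDξ : ∀ a, ι (Dξ a) = qξ a)
    (hιDρ : ∀ a b, ι (Dρ a b) = qρ a b)
    (hιLξ : ∀ a x, ι (ξ a * x) = ξ a * ι x)
    (hιLρ : ∀ a b x, ι (ρ a b * x) = ρ a b * ι x)
    (hιLDξ : ∀ a x, ι (Dξ a * x) = qξ a * x + Dξ a * ι x)
    (hιLDρ : ∀ a b x, ι (Dρ a b * x) = qρ a b * x + Dρ a b * ι x) :
    ι (ι (∑ a, ∑ b, ∑ c, Vthree ξ a b c * (Dξ a * Dρ b c))) = 0 := by
  obtain ⟨N, rfl⟩ : ∃ N, n = N + 3 := ⟨n - 3, by omega⟩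
  -- reduction to a function
  have hιl : ∀ (l : List (Fin (N+3))) (x : A),
      ι ((l.map ξ).prod * x) = (l.map ξ).prod * ι x := by
    intro l x
    induction l with
    | nil => simp
    | cons a l ih => simp [mul_assoc, hιLξ, ih]
  have hιV : ∀ a b c x, ι (Vthree ξ a b c * x) = Vthree ξ a b c * ι x := by
    intro a b c x
    unfold Vthree
    simp only [smul_mul_assoc, Finset.sum_mul, map_smul, map_sum]
    congr 1
    refine Finset.sum_congr rfl fun f _ => ?_
    have := hιl (List.ofFn f) x
    rw [List.map_ofFn] at this
    congr 1
  have hιqξ : ∀ a x, ι (qξ a * x) = qξ a * ι x := by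
    intro a x
    simp only [hqξ, Finset.sum_mul, map_sum, smul_mul_assoc, map_smul, mul_assoc, hιLξ, hιLρ]
  have hιqρ : ∀ a b, ι (qρ a b) = 0 := by
    intro a b
    simp [hqρ, hιLξ, hιLρ, hιξ, hιρ]
  have hDD : ∀ a b c, ι (ι (Dξ a * Dρ b c)) = (2:ℝ) • (qξ a * qρ b c) := by
    intro a b c
    rw [hιLDξ, map_add, hιqξ, hιDρ, hιLDξ, hιqρ, mul_zero, add_zero, two_smul]
  simp only [map_sum, hιV, hDD, mul_smul_comm]
  simp only [← Finset.smul_sum]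
  -- abbreviations
  let r : Fin (N+3) → Fin (N+3) → A := fun a d => ∑ e, η e d • ρ a e
  let K : Fin (N+3) → Fin (N+3) → A := fun b c => ∑ x, ∑ y, η x y • (ρ b x * ρ y c)
  have hξr : ∀ d a e, r a e * ξ d = - (ξ d * r a e) := by
    intro d a e
    simp [r, Finset.sum_mul, Finset.mul_sum, hξρ]
  have hqξ' : ∀ a, qξ a = ∑ d, r a d * ξ d := by
    intro a
    simp only [hqξ, r, Finset.sum_mul, smul_mul_assoc]
  have htr : ∑ k, r k k = 0 := by
    apply self_neg_zero
    simp only [r]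
    conv_rhs => rw [Finset.sum_comm]
    simp only [← Finset.sum_neg_distrib]
    refine Finset.sum_congr rfl fun i _ => Finset.sum_congr rfl fun j _ => ?_
    rw [hρa i j, hη i j, smul_neg]
  have hK : ∀ b c, K b c = - K c b := by
    intro b c
    simp only [K]
    conv_rhs => rw [Finset.sum_comm]
    simp only [← Finset.sum_neg_distrib]
    refine Finset.sum_congr rfl fun i _ => Finset.sum_congr rfl fun j _ => ?_
    rw [hρρ b i j c, hη i j, hρa j c, hρa b i, smul_neg]
    simp
  have hM : ∀ b c, ∑ k, r b k * K k c = ∑ k, r c k * K k b := by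
    have ex : ∀ b c, ∑ k, r b k * K k c =
        ∑ k, ∑ e, ∑ x, ∑ y, (η e k * η x y) • (ρ b e * (ρ k x * ρ y c)) := by
      intro b c
      refine Finset.sum_congr rfl fun k _ => ?_
      simp only [r]
      rw [Finset.sum_mul]
      refine Finset.sum_congr rfl fun e _ => ?_
      simp only [K, Finset.mul_sum, smul_mul_smul_comm]
    intro b c
    rw [ex, ex]
    have rev : ∀ b e k x y c, ρ b e * (ρ k x * ρ y c) = ρ c y * (ρ x k * ρ e b) := by
      intro b e k x y c
      rw [hρa c y, hρa x k, hρa e b]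
      rw [← mul_assoc, hρρ b e k x, neg_mul, mul_assoc, hρρ b e y c, mul_neg, neg_neg,
        ← mul_assoc, hρρ k x y c]
      simp [mul_assoc]
    -- reindex (k,e,x,y) ↦ (x,y,k,e)
    have re : ∀ G : Fin (N+3) → Fin (N+3) → Fin (N+3) → Fin (N+3) → A,
        ∑ k, ∑ e, ∑ x, ∑ y, G k e x y = ∑ k, ∑ e, ∑ x, ∑ y, G x y k e := by
      intro G
      simp only [← Fintype.sum_prod_type']
      have h1 := Finset.sum_comm (s := Finset.univ) (t := Finset.univ)
        (f := fun (p q : Fin (N+3) × Fin (N+3)) => G p.1 p.2 q.1 q.2)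
      simp only [Fintype.sum_prod_type] at h1 ⊢
      exact h1
    rw [re]
    refine Finset.sum_congr rfl fun k _ => Finset.sum_congr rfl fun e _ =>
      Finset.sum_congr rfl fun x _ => Finset.sum_congr rfl fun y _ => ?_
    rw [rev, mul_comm (η y x), hη k e, hη y x]
  have hsplit : ∀ a b c, qξ a * qρ b c = (∑ d, ξ d * (-(r a d * K b c)))
      - lam • (∑ d, ξ d * ξ b * ξ c * r a d) := by
    intro a b c
    have h1 : qρ b c = K b c + lam • (ξ b * ξ c) := hqρ b c
    rw [hqξ', h1, mul_add, sub_eq_add_neg, mul_smul_comm, ← smul_neg]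
    congr 1
    · rw [Finset.sum_mul]
      refine Finset.sum_congr rfl fun d _ => ?_
      rw [hξr]; simp [mul_assoc]
    · rw [Finset.sum_mul, ← Finset.sum_neg_distrib]
      congr 1
      refine Finset.sum_congr rfl fun d _ => ?_
      rw [hξr, neg_mul, neg_inj, mul_assoc, ← mul_assoc (r a d), hξr, neg_mul, mul_assoc (ξ b), hξr]
      simp [mul_assoc]
  simp only [hsplit, mul_sub, Finset.sum_sub_distrib, mul_smul_comm, ← Finset.smul_sum]
  rw [term_three ξ hξξ r htr, term_one ξ hξξ (fun a b c d => -(r a d * K b c))]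
  · simp
  · intro b c
    simp only [Finset.sum_sub_distrib, Finset.sum_neg_distrib, ← Finset.sum_mul, htr]
    rw [hM b c]
    have : ∑ k, r c k * K b k = - ∑ k, r c k * K k b := by
      rw [← Finset.sum_neg_distrib]
      refine Finset.sum_congr rfl fun k _ => ?_
      rw [hK b k, mul_neg]
    rw [this]
    simp
  · intro a b d
    rw [self_neg_zero (hK b b)]
    simp
end
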